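/- In the Subbotin sparse sequence model with parameter ζ > 1, for any integer ρ ≥ 1, any 0 ≤ ε ≤ 1, any s_n > 4 (with s_n ≤ n), and any 𝐛 = (b_1,…,b_{s_n}) with b_j > −(ζ log(n/s_n))^{1/ζ}, one has the non-asymptotic lower bound: inf_φ sup_{θ∈Θ_𝐛} P_θ( L_ρ(θ,φ) ≥ min(1 − (1+ε)/√s_n, 𝔉̄_n(𝐛,ρ) − ε) · ρ s_n ) ≥ 1 − exp(−√s_n · ε²/3), where the infimum is over all multiple testing procedures φ. -/

import Mathlib

open MeasureTheory ProbabilityTheory Filter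
open scoped Classical ENNReal

noncomputable section

/-- Unnormalized Subbotin density `e^{-|x|^ζ/ζ}`. -/
def sDensity (ζ : ℝ) (x : ℝ) : ℝ := Real.exp (-|x| ^ ζ / ζ)

/-- Normalizing constant `L_ζ = ∫ e^{-|x|^ζ/ζ} dx`. -/
def Lz (ζ : ℝ) : ℝ := ∫ x : ℝ, sDensity ζ x

/-- Subbotin density `f(x) = L_ζ⁻¹ e^{-|x|^ζ/ζ}`. -/
def sf (ζ : ℝ) (x : ℝ) : ℝ := (Lz ζ)⁻¹ * sDensity ζ x

/-- Subbotin noise distribution: the measure with density `f` w.r.t. Lebesgue measure. -/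
def noiseMeasure (ζ : ℝ) : Measure ℝ :=
  MeasureTheory.volume.withDensity fun x => ENNReal.ofReal (sf ζ x)

/-- Subbotin upper tail function `F̄(x) = ∫_x^∞ f(u) du`. -/
def Fbar (ζ : ℝ) (x : ℝ) : ℝ := ∫ u in Set.Ioi x, sf ζ u

/-- Law of the observation `X = θ + ε` with `ε_i` i.i.d. Subbotin(ζ) noise. -/
def obsLaw {n : ℕ} (ζ : ℝ) (θ : Fin n → ℝ) : Measure (Fin n → ℝ) :=
  Measure.pi fun i =>
    MeasureTheory.volume.withDensity fun x => ENNReal.ofReal (sf ζ (x - θ i))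

/-- Number of rejections of the decision vector `v`. -/
def numRej {n : ℕ} (v : Fin n → Bool) : ℕ :=
  (Finset.univ.filter fun i => v i = true).card

/-- Support of `θ`. -/
def supp {n : ℕ} (θ : Fin n → ℝ) : Finset (Fin n) :=
  Finset.univ.filter fun i => θ i ≠ 0

/-- False discovery proportion. -/
def FDP {n : ℕ} (θ : Fin n → ℝ) (v : Fin n → Bool) : ℝ :=
  ((Finset.univ.filter fun i => θ i = 0 ∧ v i = true).card : ℝ) / max 1 (numRej v : ℝ)

/-- False negative proportion. -/
def FNP {n : ℕ} (θ : Fin n → ℝ) (v : Fin n → Bool) : ℝ :=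
  ((Finset.univ.filter fun i => θ i ≠ 0 ∧ v i = false).card : ℝ) / max 1 ((supp θ).card : ℝ)

/-- False discovery rate. -/
def FDR {n : ℕ} (ζ : ℝ) (θ : Fin n → ℝ) (φ : (Fin n → ℝ) → Fin n → Bool) : ℝ :=
  ∫ x, FDP θ (φ x) ∂(obsLaw ζ θ)

/-- False negative rate. -/
def FNR {n : ℕ} (ζ : ℝ) (θ : Fin n → ℝ) (φ : (Fin n → ℝ) → Fin n → Bool) : ℝ :=
  ∫ x, FNP θ (φ x) ∂(obsLaw ζ θ)

/-- Combined multiple testing risk `𝔎 = FDR + FNR`. -/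
def mtRisk {n : ℕ} (ζ : ℝ) (θ : Fin n → ℝ) (φ : (Fin n → ℝ) → Fin n → Bool) : ℝ :=
  FDR ζ θ φ + FNR ζ θ φ

/-- Oracle threshold `a* = (ζ log(n/s_n))^{1/ζ}`. -/
def astar (ζ : ℝ) (n s : ℕ) : ℝ := (ζ * Real.log ((n : ℝ) / (s : ℝ))) ^ (1 / ζ)

/-- The class `Θ_𝐛`: sparse vectors with `s` coordinates (at distinct positions) whose
absolute values are at least `a* + b_j`, `j = 1, …, s`. -/
def ThetaMult (ζ : ℝ) (n s : ℕ) (b : Fin s → ℝ) : Set (Fin n → ℝ) :=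
  {θ | (supp θ).card ≤ s ∧
    ∃ ι : Fin s → Fin n, Function.Injective ι ∧
      ∀ j, astar ζ n s + b j ≤ |θ (ι j)|}

/-- `Λ_n(𝐛) = s⁻¹ Σ_j F̄(b_j)`. -/
def Lambda (ζ : ℝ) (s : ℕ) (b : Fin s → ℝ) : ℝ := (∑ j, Fbar ζ (b j)) / (s : ℝ)

/-- `p_n(b,ρ) = P(#{2 ≤ i ≤ ⌊n/s⌋ : ε_i > a_b + ε_1} ≥ ρ)` for i.i.d. Subbotin noise,
realised on the product space `ℝ × (Fin (⌊n/s⌋ - 1) → ℝ)` where the first coordinate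
plays the role of `ε_1`. -/
def pn (ζ : ℝ) (n s : ℕ) (b : ℝ) (ρ : ℕ) : ℝ :=
  (((noiseMeasure ζ).prod (Measure.pi fun _ : Fin (n / s - 1) => noiseMeasure ζ))
    {p | ρ ≤ (Finset.univ.filter fun i => astar ζ n s + b + p.1 < p.2 i).card}).toReal

/-- `𝔉̄_n(𝐛,ρ) = s⁻¹ Σ_j p_n(b_j,ρ)`. -/
def Fcal (ζ : ℝ) (n s : ℕ) (b : Fin s → ℝ) (ρ : ℕ) : ℝ :=
  (∑ j, pn ζ n s (b j) ρ) / (s : ℝ)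

/-- `ω_{δ,q} = exp(−(⌊q⌋−1) F̄((ζ log q)^{1/ζ} − δ))`. -/
def omegaDQ (ζ δ q : ℝ) : ℝ :=
  Real.exp (-((⌊q⌋ : ℝ) - 1) * Fbar ζ ((ζ * Real.log q) ^ (1 / ζ) - δ))

/-- Weighted classification loss `L_ρ`. -/
def Lweight {n : ℕ} (ρ : ℝ) (θ : Fin n → ℝ) (v : Fin n → Bool) : ℝ :=
  ((Finset.univ.filter fun i => θ i = 0 ∧ v i = true).card : ℝ) +
    ρ * ((Finset.univ.filter fun i => θ i ≠ 0 ∧ v i = false).card : ℝ)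

lemma integrable_sDensity {ζ : ℝ} (hζ : 1 < ζ) : Integrable (sDensity ζ) := by
  have h := integrableOn_rpow_mul_exp_neg_mul_rpow (p := ζ) (s := 0) (b := ζ⁻¹)
    (by norm_num) (by linarith) (by positivity)
  have hpos : IntegrableOn (sDensity ζ) (Set.Ioi 0) := by
    refine h.congr_fun (fun x hx => ?_) measurableSet_Ioi
    simp only [sDensity, Real.rpow_zero, one_mul, abs_of_pos (Set.mem_Ioi.mp hx)]
    congr 1
    ring
  have hneg : IntegrableOn (sDensity ζ) (Set.Iic 0) := by
    rw [← integrableOn_Ici_iff_integrableOn_Ioi, ← neg_zero] at hpos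
    have := hpos.comp_neg_Iic
    refine this.congr_fun (fun x _ => ?_) measurableSet_Iic
    simp [sDensity]
  rw [← integrableOn_univ, ← Set.Iic_union_Ioi (a := (0 : ℝ))]
  exact hneg.union hpos

lemma Lz_pos {ζ : ℝ} (hζ : 1 < ζ) : 0 < Lz ζ :=
  integral_exp_pos (integrable_sDensity hζ)

lemma sf_pos {ζ : ℝ} (hζ : 1 < ζ) (x : ℝ) : 0 < sf ζ x :=
  mul_pos (inv_pos.mpr (Lz_pos hζ)) (Real.exp_pos _)

lemma measurable_sf (ζ : ℝ) : Measurable (sf ζ) := by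
  unfold sf sDensity
  fun_prop

lemma isProbabilityMeasure_noiseMeasure {ζ : ℝ} (hζ : 1 < ζ) :
    IsProbabilityMeasure (noiseMeasure ζ) := by
  constructor
  rw [noiseMeasure, withDensity_apply _ MeasurableSet.univ, Measure.restrict_univ,
    ← ofReal_integral_eq_lintegral_ofReal (f := sf ζ) ((integrable_sDensity hζ).const_mul _)
      (Eventually.of_forall fun x => (sf_pos hζ x).le)]
  simp only [sf, integral_const_mul]
  rw [← Lz, inv_mul_cancel₀ (Lz_pos hζ).ne', ENNReal.ofReal_one]

/-- Likelihood ratio of the noise shifted by `a` with respect to the noise. -/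
def shiftRatio (ζ a x : ℝ) : ℝ≥0∞ := ENNReal.ofReal (sf ζ (x - a) / sf ζ x)

lemma measurable_shiftRatio (ζ a : ℝ) : Measurable (shiftRatio ζ a) := by
  have := measurable_sf ζ
  unfold shiftRatio
  fun_prop

lemma shiftRatio_zero {ζ : ℝ} (hζ : 1 < ζ) (x : ℝ) : shiftRatio ζ 0 x = 1 := by
  simp [shiftRatio, div_self (sf_pos hζ x).ne']

lemma convexOn_abs_rpow {ζ : ℝ} (hζ : 1 ≤ ζ) : ConvexOn ℝ Set.univ fun x : ℝ => |x| ^ ζ := by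
  refine ⟨convex_univ, fun x _ y _ u v hu hv huv => ?_⟩
  calc |u • x + v • y| ^ ζ ≤ (u • |x| + v • |y|) ^ ζ := by
        refine Real.rpow_le_rpow (abs_nonneg _) ?_ (by linarith)
        simpa [abs_mul, abs_of_nonneg hu, abs_of_nonneg hv] using abs_add_le (u * x) (v * y)
    _ ≤ u • |x| ^ ζ + v • |y| ^ ζ :=
        (convexOn_rpow hζ).2 (abs_nonneg x) (abs_nonneg y) hu hv huv

lemma ConvexOn.add_le_add_of_shift {g : ℝ → ℝ} (hg : ConvexOn ℝ Set.univ g) {x y a : ℝ}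
    (hxy : x ≤ y) (ha : 0 ≤ a) : g x + g (y - a) ≤ g y + g (x - a) := by
  rcases eq_or_lt_of_le ha with rfl | ha
  · simp [add_comm]
  have hd : 0 < y - x + a := by linarith
  have hsum : (y - x) / (y - x + a) + a / (y - x + a) = 1 := by field_simp
  have hu : 0 ≤ (y - x) / (y - x + a) := div_nonneg (by linarith) hd.le
  have hv : 0 ≤ a / (y - x + a) := by positivity
  have h1 := hg.2 (Set.mem_univ (x - a)) (Set.mem_univ y) hu hv hsum
  have h2 := hg.2 (Set.mem_univ (x - a)) (Set.mem_univ y) hv hu (by rwa [add_comm])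
  have e1 : ((y - x) / (y - x + a)) • (x - a) + (a / (y - x + a)) • y = x := by
    simp only [smul_eq_mul]
    field_simp
    ring
  have e2 : (a / (y - x + a)) • (x - a) + ((y - x) / (y - x + a)) • y = y - a := by
    simp only [smul_eq_mul]
    field_simp
    ring
  rw [e1] at h1
  rw [e2] at h2
  simp only [smul_eq_mul] at h1 h2
  linear_combination h1 + h2 + (g (x - a) + g y) * hsum

/-- The Subbotin family has monotone likelihood ratio in the location parameter. -/
lemma shiftRatio_mono {ζ : ℝ} (hζ : 1 < ζ) {a : ℝ} (ha : 0 ≤ a) : Monotone (shiftRatio ζ a) := by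
  intro x y hxy
  have key := (convexOn_abs_rpow hζ.le).add_le_add_of_shift hxy ha
  refine ENNReal.ofReal_le_ofReal ?_
  rw [div_le_div_iff₀ (sf_pos hζ x) (sf_pos hζ y)]
  have : sDensity ζ (x - a) * sDensity ζ y ≤ sDensity ζ (y - a) * sDensity ζ x := by
    simp only [sDensity, ← Real.exp_add]
    rw [Real.exp_le_exp, ← add_div, ← add_div]
    exact div_le_div_of_nonneg_right (by linarith) (by linarith)
  simp only [sf]
  have hL := inv_pos.mpr (Lz_pos hζ)
  nlinarith [mul_le_mul_of_nonneg_left this (mul_pos hL hL).le]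

lemma withDensity_shift_eq {ζ : ℝ} (hζ : 1 < ζ) (a : ℝ) :
    (volume.withDensity fun x => ENNReal.ofReal (sf ζ (x - a))) =
      (noiseMeasure ζ).withDensity (shiftRatio ζ a) := by
  rw [noiseMeasure, ← withDensity_mul _ (measurable_sf ζ).ennreal_ofReal
    (measurable_shiftRatio ζ a)]
  congr 1
  ext x
  simp only [Pi.mul_apply, shiftRatio]
  rw [← ENNReal.ofReal_mul (sf_pos hζ x).le, mul_div_cancel₀ _ (sf_pos hζ x).ne']

lemma lintegral_noise_mul_shiftRatio {ζ : ℝ} (hζ : 1 < ζ) (a : ℝ) {h : ℝ → ℝ≥0∞}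
    (hh : Measurable h) :
    ∫⁻ x, h x * shiftRatio ζ a x ∂noiseMeasure ζ = ∫⁻ x, h (a + x) ∂noiseMeasure ζ := by
  have hm := (measurable_sf ζ).ennreal_ofReal
  have h1 : ∫⁻ x, h x * shiftRatio ζ a x ∂noiseMeasure ζ =
      ∫⁻ x, h x ∂(noiseMeasure ζ).withDensity (shiftRatio ζ a) := by
    rw [lintegral_withDensity_eq_lintegral_mul _ (measurable_shiftRatio ζ a) hh]
    simp [mul_comm]
  rw [h1, ← withDensity_shift_eq hζ,
    lintegral_withDensity_eq_lintegral_mul _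
      (show Measurable fun x => ENNReal.ofReal (sf ζ (x - a)) from
        hm.comp (measurable_id.sub_const a)) hh,
    noiseMeasure, lintegral_withDensity_eq_lintegral_mul _ hm
      (show Measurable fun x => h (a + x) from hh.comp (measurable_const_add a)),
    ← lintegral_add_left_eq_self _ a]
  simp

lemma pi_withDensity {ι : Type*} [Fintype ι] {α : Type*} [MeasurableSpace α]
    (μ : Measure α) [IsProbabilityMeasure μ] (r : ι → α → ℝ≥0∞) (hr : ∀ i, Measurable (r i))
    [∀ i, SigmaFinite (μ.withDensity (r i))] :
    Measure.pi (fun i => μ.withDensity (r i)) =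
      (Measure.pi fun _ => μ).withDensity fun x => ∏ i, r i (x i) := by
  refine Measure.pi_eq fun t ht => ?_
  rw [withDensity_apply _ (MeasurableSet.univ_pi ht),
    ← lintegral_indicator (MeasurableSet.univ_pi ht)]
  have hind : ∀ x : ι → α, (Set.univ.pi t).indicator (fun x => ∏ i, r i (x i)) x =
      ∏ i, (t i).indicator (r i) (x i) := by
    intro x
    by_cases hx : x ∈ Set.univ.pi t
    · rw [Set.indicator_of_mem hx]
      exact Finset.prod_congr rfl fun i _ => (Set.indicator_of_mem (hx i trivial) _).symm
    · rw [Set.indicator_of_notMem hx]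
      obtain ⟨i, hi⟩ : ∃ i, x i ∉ t i := by simpa using hx
      exact (Finset.prod_eq_zero (Finset.mem_univ i) (Set.indicator_of_notMem hi _)).symm
  simp_rw [hind]
  have hmeas : ∀ i, Measurable ((t i).indicator (r i)) := fun i => (hr i).indicator (ht i)
  rw [lintegral_prod_eq_prod_lintegral_of_indepFun Finset.univ
    (fun i (x : ι → α) => (t i).indicator (r i) (x i))
    (iIndepFun_pi fun i => (hmeas i).aemeasurable) fun i => (hmeas i).comp (measurable_pi_apply i)]
  refine Finset.prod_congr rfl fun i _ => ?_
  rw [(measurePreserving_eval (fun _ => μ) i).lintegral_comp (hmeas i),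
    lintegral_indicator (ht i), withDensity_apply _ (ht i)]

lemma isProbabilityMeasure_shift {ζ : ℝ} (hζ : 1 < ζ) (a : ℝ) :
    IsProbabilityMeasure ((noiseMeasure ζ).withDensity (shiftRatio ζ a)) := by
  have := isProbabilityMeasure_noiseMeasure hζ
  constructor
  rw [withDensity_apply _ MeasurableSet.univ, Measure.restrict_univ]
  simpa using lintegral_noise_mul_shiftRatio hζ a (h := fun _ => 1) measurable_const

lemma obsLaw_eq_withDensity {ζ : ℝ} (hζ : 1 < ζ) {n : ℕ} (θ : Fin n → ℝ) :
    obsLaw ζ θ = (Measure.pi fun _ => noiseMeasure ζ).withDensity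
      fun x => ∏ k, shiftRatio ζ (θ k) (x k) := by
  have := isProbabilityMeasure_noiseMeasure hζ
  have := isProbabilityMeasure_shift hζ
  simp_rw [obsLaw, withDensity_shift_eq hζ]
  exact pi_withDensity _ _ fun k => measurable_shiftRatio ζ (θ k)

lemma isProbabilityMeasure_obsLaw {ζ : ℝ} (hζ : 1 < ζ) {n : ℕ} (θ : Fin n → ℝ) :
    IsProbabilityMeasure (obsLaw ζ θ) := by
  have := isProbabilityMeasure_shift hζ
  simp_rw [obsLaw, withDensity_shift_eq hζ]
  infer_instance

/-- Under a product law, disjoint blocks of coordinates are independent. -/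
lemma map_pi_blocks {α : Type*} [MeasurableSpace α] (μ : Measure α) [IsProbabilityMeasure μ]
    {n s q : ℕ} {e : Fin s × Fin q → Fin n} (he : Function.Injective e) :
    (Measure.pi fun _ : Fin n => μ).map (fun x j i => x (e (j, i))) =
      Measure.pi fun _ : Fin s => Measure.pi fun _ : Fin q => μ := by
  have h1 := Measure.map_infinitePi_infinitePi_of_inj (P := fun _ : Fin n => μ) he
  have h2 := Measure.infinitePi_map_curry (fun (_ : Fin s) (_ : Fin q) => μ)
  rw [← h1, Measure.map_map (MeasurableEquiv.measurable _) (by fun_prop)] at h2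
  simp only [Measure.infinitePi_eq_pi] at h2
  exact h2

lemma lintegral_prod_blocks {α : Type*} [MeasurableSpace α] (μ : Measure α)
    [IsProbabilityMeasure μ] {n s q : ℕ} {e : Fin s × Fin q → Fin n}
    (he : Function.Injective e) {G : Fin s → (Fin q → α) → ℝ≥0∞} (hG : ∀ j, Measurable (G j)) :
    ∫⁻ x : Fin n → α, ∏ j, G j (fun i => x (e (j, i))) ∂(Measure.pi fun _ => μ) =
      ∏ j, ∫⁻ y, G j y ∂(Measure.pi fun _ => μ) := by
  rw [← lintegral_map (μ := Measure.pi fun _ : Fin n => μ)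
    (f := fun z : Fin s → Fin q → α => ∏ j, G j (z j)) (g := fun x j i => x (e (j, i)))
    (by fun_prop) (by fun_prop), map_pi_blocks μ he,
    lintegral_prod_eq_prod_lintegral_of_indepFun Finset.univ
      (fun j (z : Fin s → Fin q → α) => G j (z j))
      (iIndepFun_pi fun j => (hG j).aemeasurable) fun j => (hG j).comp (measurable_pi_apply j)]
  exact Finset.prod_congr rfl fun j _ =>
    (measurePreserving_eval (fun _ : Fin s => Measure.pi fun _ : Fin q => μ) j).lintegral_comp
      (hG j)

/-- Indices whose value is exceeded by fewer than `ρ` entries of `y`. -/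
def topSet {ι : Type*} [Fintype ι] (ρ : ℕ) (y : ι → ℝ) : Finset ι :=
  Finset.univ.filter fun i => (Finset.univ.filter fun k => y i < y k).card < ρ

lemma mem_topSet {ι : Type*} [Fintype ι] {ρ : ℕ} {y : ι → ℝ} {i : ι} :
    i ∈ topSet ρ y ↔ (Finset.univ.filter fun k => y i < y k).card < ρ := by
  simp [topSet]

lemma mem_topSet_of_le {ι : Type*} [Fintype ι] {ρ : ℕ} {y : ι → ℝ} {i k : ι}
    (hi : i ∈ topSet ρ y) (hik : y i ≤ y k) : k ∈ topSet ρ y := by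
  rw [mem_topSet] at hi ⊢
  refine (Finset.card_le_card fun l hl => ?_).trans_lt hi
  simp only [Finset.mem_filter, Finset.mem_univ, true_and] at hl ⊢
  exact hik.trans_lt hl

lemma le_card_topSet {ι : Type*} [Fintype ι] {ρ : ℕ} {y : ι → ℝ} {i : ι}
    (hi : i ∉ topSet ρ y) : ρ ≤ (topSet ρ y).card := by
  obtain ⟨k, hk, hmax⟩ := (topSet ρ y)ᶜ.exists_max_image y ⟨i, by simpa using hi⟩
  rw [Finset.mem_compl] at hk
  rw [mem_topSet, not_lt] at hk
  refine hk.trans (Finset.card_le_card fun l hl => ?_)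
  by_contra hl'
  exact absurd (hmax l (by simpa using hl')) (by simpa using hl)

/-- Among sets of at most `ρ` indices, none carries more weight than the top set. -/
lemma sum_le_sum_topSet {ι : Type*} [Fintype ι] {ρ : ℕ} {y : ι → ℝ} {w : ι → ℝ≥0∞}
    (hw : ∀ i k, y i ≤ y k → w i ≤ w k) {R : Finset ι} (hR : R.card ≤ ρ) :
    ∑ i ∈ R, w i ≤ ∑ i ∈ topSet ρ y, w i := by
  set T := topSet ρ y
  by_cases hsub : R \ T = ∅
  · exact Finset.sum_le_sum_of_subset (Finset.sdiff_eq_empty_iff_subset.mp hsub)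
  obtain ⟨k, hk, hmax⟩ := (R \ T).exists_max_image w (Finset.nonempty_iff_ne_empty.mpr hsub)
  have hkT : k ∉ T := (Finset.mem_sdiff.mp hk).2
  have hcard : (R \ T).card ≤ (T \ R).card := by
    have h1 := Finset.card_sdiff_add_card_inter R T
    have h2 := Finset.card_sdiff_add_card_inter T R
    have h3 : ρ ≤ T.card := le_card_topSet hkT
    rw [Finset.inter_comm] at h2
    omega
  rw [← Finset.sum_inter_add_sum_sdiff R T, ← Finset.sum_inter_add_sum_sdiff T R,
    Finset.inter_comm T R]
  gcongr _ + ?_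
  calc ∑ i ∈ R \ T, w i ≤ (R \ T).card • w k := Finset.sum_le_card_nsmul _ _ _ hmax
    _ ≤ (T \ R).card • w k := by gcongr
    _ ≤ ∑ i ∈ T \ R, w i := Finset.card_nsmul_le_sum _ _ _ fun i hi => hw k i <| by
        by_contra! h
        exact hkT (mem_topSet_of_le (Finset.mem_sdiff.mp hi).1 h.le)

lemma measurable_card_exceed {m : ℕ} : Measurable fun p : ℝ × (Fin m → ℝ) =>
    (Finset.univ.filter fun k => p.1 < p.2 k).card := by
  simp_rw [Finset.card_filter]
  refine Finset.measurable_sum _ fun k _ => ?_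
  exact Measurable.ite (measurableSet_lt (by fun_prop) (by fun_prop)) measurable_const
    measurable_const

/-- Probability that the shifted noise is exceeded by fewer than `ρ` of `m` noise variables. -/
def topProb (ζ : ℝ) (m : ℕ) (a : ℝ) (ρ : ℕ) : ℝ≥0∞ :=
  ((noiseMeasure ζ).prod (Measure.pi fun _ : Fin m => noiseMeasure ζ))
    {p | (Finset.univ.filter fun k => a + p.1 < p.2 k).card < ρ}

lemma measurableSet_card_exceed_lt {m : ℕ} (a : ℝ) (ρ : ℕ) :
    MeasurableSet {p : ℝ × (Fin m → ℝ) |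
      (Finset.univ.filter fun k => a + p.1 < p.2 k).card < ρ} :=
  (measurable_card_exceed.comp (f := fun p : ℝ × (Fin m → ℝ) => (a + p.1, p.2)) (by fun_prop))
    (measurableSet_Iio (a := ρ))

lemma topProb_eq {ζ : ℝ} (hζ : 1 < ζ) {n s m : ℕ} (hm : n / s = m + 1) (b : ℝ) (ρ : ℕ) :
    topProb ζ m (astar ζ n s + b) ρ = ENNReal.ofReal (1 - pn ζ n s b ρ) := by
  have := isProbabilityMeasure_noiseMeasure hζ
  have hm' : n / s - 1 = m := by omega
  rw [pn, hm', topProb]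
  have hS := measurableSet_card_exceed_lt (m := m) (astar ζ n s + b) ρ
  rw [← Measure.real, ← probReal_compl_eq_one_sub, ofReal_measureReal]
  · congr 1
    ext p
    simp
  · convert hS.compl using 1
    ext p
    simp

lemma pn_nonneg (ζ : ℝ) (n s : ℕ) (b : ℝ) (ρ : ℕ) : 0 ≤ pn ζ n s b ρ := ENNReal.toReal_nonneg

lemma pn_le_one {ζ : ℝ} (hζ : 1 < ζ) (n s : ℕ) (b : ℝ) (ρ : ℕ) : pn ζ n s b ρ ≤ 1 := by
  have := isProbabilityMeasure_noiseMeasure hζ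
  exact measureReal_le_one

lemma measurable_topSet_indicator {m : ℕ} (ρ : ℕ) (i : Fin (m + 1)) :
    Measurable fun y : Fin (m + 1) → ℝ => if i ∈ topSet ρ y then (1 : ℝ≥0∞) else 0 := by
  refine Measurable.ite ?_ measurable_const measurable_const
  simp_rw [mem_topSet, Finset.card_filter]
  refine measurableSet_lt (Finset.measurable_sum _ fun k _ => ?_) measurable_const
  exact Measurable.ite (measurableSet_lt (by fun_prop) (by fun_prop)) measurable_const
    measurable_const

lemma card_exceed_succAbove {m : ℕ} (y : Fin (m + 1) → ℝ) (i : Fin (m + 1)) :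
    (Finset.univ.filter fun k => y i < y k).card =
      (Finset.univ.filter fun k => y i < y (i.succAbove k)).card := by
  rw [Finset.card_filter, Finset.card_filter, Fin.sum_univ_succAbove _ i]
  simp

lemma lintegral_topSet_mul_shiftRatio {ζ : ℝ} (hζ : 1 < ζ) {m : ℕ} (a : ℝ) (ρ : ℕ)
    (i : Fin (m + 1)) :
    ∫⁻ y, (if i ∈ topSet ρ y then 1 else 0) * shiftRatio ζ a (y i)
      ∂(Measure.pi fun _ : Fin (m + 1) => noiseMeasure ζ) = topProb ζ m a ρ := by
  have := isProbabilityMeasure_noiseMeasure hζ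
  set S : Set (ℝ × (Fin m → ℝ)) := {p | (Finset.univ.filter fun k => p.1 < p.2 k).card < ρ}
  have hS : MeasurableSet S := measurable_card_exceed (measurableSet_Iio (a := ρ))
  have hr := measurable_shiftRatio ζ a
  have hg : Measurable fun p : ℝ × (Fin m → ℝ) => S.indicator 1 p * shiftRatio ζ a p.1 :=
    (measurable_one.indicator hS).mul (hr.comp measurable_fst)
  have hcomp : ∀ y : Fin (m + 1) → ℝ, (if i ∈ topSet ρ y then 1 else 0) * shiftRatio ζ a (y i) =
      (fun p : ℝ × (Fin m → ℝ) => S.indicator 1 p * shiftRatio ζ a p.1)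
        (MeasurableEquiv.piFinSuccAbove (fun _ => ℝ) i y) := by
    intro y
    simp only [mem_topSet, card_exceed_succAbove y i, Set.indicator_apply, S, Set.mem_ofPred_eq,
      Pi.one_apply]
    rfl
  simp_rw [hcomp]
  rw [(measurePreserving_piFinSuccAbove (fun _ => noiseMeasure ζ) i).lintegral_comp hg,
    lintegral_prod _ hg.aemeasurable]
  have hinner : ∀ z : ℝ, ∫⁻ w, S.indicator 1 (z, w) * shiftRatio ζ a z
      ∂(Measure.pi fun _ : Fin m => noiseMeasure ζ) =
      (Measure.pi fun _ : Fin m => noiseMeasure ζ) (Prod.mk z ⁻¹' S) * shiftRatio ζ a z := by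
    intro z
    rw [lintegral_mul_const _ (show Measurable fun w => S.indicator 1 (z, w) from
        (measurable_one.indicator hS).comp measurable_prodMk_left),
      ← lintegral_indicator_one (measurable_prodMk_left hS)]
    rfl
  simp_rw [hinner]
  rw [lintegral_noise_mul_shiftRatio hζ a
    (h := fun z => (Measure.pi fun _ : Fin m => noiseMeasure ζ) (Prod.mk z ⁻¹' S))
    (measurable_measure_prodMk_left hS), topProb,
    Measure.prod_apply (measurableSet_card_exceed_lt a ρ)]
  rfl

/-- Exponential weight of the likelihood in a block for the top-`ρ` rule: misses get weight `c`
and hits get weight `c + d`. -/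
def blockWeight (ζ a : ℝ) (ρ : ℕ) (c d : ℝ≥0∞) {q : ℕ} (y : Fin q → ℝ) : ℝ≥0∞ :=
  ∑ i, (c + d * if i ∈ topSet ρ y then 1 else 0) * shiftRatio ζ a (y i)

lemma measurable_blockWeight (ζ a : ℝ) (ρ : ℕ) (c d : ℝ≥0∞) {m : ℕ} :
    Measurable (blockWeight ζ a ρ c d (q := m + 1)) := by
  have hr := measurable_shiftRatio ζ a
  have := measurable_topSet_indicator (m := m) ρ
  unfold blockWeight
  fun_prop

lemma lintegral_blockWeight {ζ : ℝ} (hζ : 1 < ζ) (a : ℝ) (ρ : ℕ) (c d : ℝ≥0∞) {m : ℕ} :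
    ∫⁻ y, blockWeight ζ a ρ c d y ∂(Measure.pi fun _ : Fin (m + 1) => noiseMeasure ζ) =
      (m + 1 : ℕ) * (c + d * topProb ζ m a ρ) := by
  have := isProbabilityMeasure_noiseMeasure hζ
  have hr := measurable_shiftRatio ζ a
  have hT := measurable_topSet_indicator (m := m) ρ
  have hone : ∀ i : Fin (m + 1), ∫⁻ y, shiftRatio ζ a (y i)
      ∂(Measure.pi fun _ : Fin (m + 1) => noiseMeasure ζ) = 1 := by
    intro i
    rw [(measurePreserving_eval (fun _ => noiseMeasure ζ) i).lintegral_comp hr]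
    simpa using lintegral_noise_mul_shiftRatio hζ a (h := fun _ => 1) measurable_const
  unfold blockWeight
  rw [lintegral_finsetSum _ fun i _ => by fun_prop]
  simp_rw [add_mul, mul_assoc]
  have hterm : ∀ i : Fin (m + 1), ∫⁻ y, (c * shiftRatio ζ a (y i) +
      d * ((if i ∈ topSet ρ y then 1 else 0) * shiftRatio ζ a (y i)))
      ∂(Measure.pi fun _ : Fin (m + 1) => noiseMeasure ζ) = c + d * topProb ζ m a ρ := by
    intro i
    rw [lintegral_add_left (by fun_prop), lintegral_const_mul _ (by fun_prop),
      lintegral_const_mul _ (by fun_prop), hone, lintegral_topSet_mul_shiftRatio hζ, mul_one]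
  simp only [hterm, Finset.sum_const, Finset.card_univ, Fintype.card_fin, nsmul_eq_mul]

/-- No rule selecting a set `R` of indices has a smaller chance of missing the signal or making
more than `ρ` rejections than the top-`ρ` rule. -/
lemma sum_weight_le_blockWeight {ζ : ℝ} (hζ : 1 < ζ) {a : ℝ} (ha : 0 ≤ a) (ρ : ℕ) (c d : ℝ≥0∞)
    {q : ℕ} (y : Fin q → ℝ) (R : Finset (Fin q)) :
    ∑ i, (c + d * if i ∈ R ∧ R.card ≤ ρ then 1 else 0) * shiftRatio ζ a (y i) ≤
      blockWeight ζ a ρ c d y := by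
  unfold blockWeight
  simp_rw [add_mul, mul_assoc, Finset.sum_add_distrib, ← Finset.mul_sum]
  gcongr _ + d * ?_
  simp only [ite_mul, one_mul, zero_mul]
  by_cases hR : R.card ≤ ρ
  · simp only [hR, and_true, Finset.sum_ite_mem, Finset.univ_inter]
    exact sum_le_sum_topSet (fun i k hik => shiftRatio_mono hζ ha hik) hR
  · simp [hR]

section Blocks

variable {n s q : ℕ} {e : Fin s × Fin q → Fin n}

/-- The vector with value `a j` at position `I j` of block `j`, and zero elsewhere. -/
def blockSignal (e : Fin s × Fin q → Fin n) (a : Fin s → ℝ) (I : Fin s → Fin q) : Fin n → ℝ :=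
  Function.extend (fun j => e (j, I j)) a 0

lemma injective_block_position (he : Function.Injective e) (I : Fin s → Fin q) :
    Function.Injective fun j => e (j, I j) :=
  fun _ _ h => congrArg Prod.fst (he h)

lemma blockSignal_apply (he : Function.Injective e) (a : Fin s → ℝ) (I : Fin s → Fin q)
    (j : Fin s) : blockSignal e a I (e (j, I j)) = a j :=
  (injective_block_position he I).extend_apply a 0 j

lemma blockSignal_of_ne (he : Function.Injective e) (a : Fin s → ℝ) (I : Fin s → Fin q)
    {j : Fin s} {i : Fin q} (hi : i ≠ I j) : blockSignal e a I (e (j, i)) = 0 := by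
  refine Function.extend_apply' _ _ _ ?_
  rintro ⟨k, hk⟩
  have h := he hk
  simp only [Prod.mk.injEq] at h
  obtain ⟨rfl, h⟩ := h
  exact hi h.symm

lemma blockSignal_mem_ThetaMult {ζ : ℝ} (he : Function.Injective e) (b : Fin s → ℝ)
    (I : Fin s → Fin q) :
    blockSignal e (fun j => astar ζ n s + b j) I ∈ ThetaMult ζ n s b := by
  refine ⟨?_, fun j => e (j, I j), injective_block_position he I, fun j => ?_⟩
  · have hsub : supp (blockSignal e (fun j => astar ζ n s + b j) I) ⊆
        Finset.univ.image fun j => e (j, I j) := by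
      intro k hk
      simp only [supp, Finset.mem_filter, Finset.mem_univ, true_and] at hk
      by_contra hk'
      exact hk (Function.extend_apply' _ _ _ (by simpa using hk'))
    simpa using (Finset.card_le_card hsub).trans Finset.card_image_le
  · rw [blockSignal_apply he]
    exact le_abs_self _

lemma prod_shiftRatio_blockSignal {ζ : ℝ} (hζ : 1 < ζ) (he : Function.Injective e)
    (a : Fin s → ℝ) (I : Fin s → Fin q) (x : Fin n → ℝ) :
    ∏ k, shiftRatio ζ (blockSignal e a I k) (x k) =
      ∏ j, shiftRatio ζ (a j) (x (e (j, I j))) := by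
  refine (Fintype.prod_of_injective _ (injective_block_position he I) _ _ (fun k hk => ?_)
    fun j => ?_).symm
  · rw [blockSignal, Function.extend_apply' _ _ _ (by simpa using hk), Pi.zero_apply,
      shiftRatio_zero hζ]
  · rw [blockSignal_apply he]

/-- Positions rejected by the decision vector `v` within block `j`. -/
def blockRej (e : Fin s × Fin q → Fin n) (v : Fin n → Bool) (j : Fin s) : Finset (Fin q) :=
  Finset.univ.filter fun i => v (e (j, i)) = true

/-- Block `j` is a hit when its signal is rejected and there are at most `ρ` rejections. -/
def IsHit (e : Fin s × Fin q → Fin n) (ρ : ℕ) (v : Fin n → Bool) (j : Fin s) (i : Fin q) : Prop :=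
  i ∈ blockRej e v j ∧ (blockRej e v j).card ≤ ρ

lemma card_miss_le_Lweight (he : Function.Injective e) {a : Fin s → ℝ} (ha : ∀ j, a j ≠ 0)
    (ρ : ℕ) (I : Fin s → Fin q) (v : Fin n → Bool) :
    (ρ : ℝ) * (Finset.univ.filter fun j => ¬ IsHit e ρ v j (I j)).card ≤
      Lweight ρ (blockSignal e a I) v := by
  have hfp : ∑ j, ((blockRej e v j).erase (I j)).card ≤
      (Finset.univ.filter fun k => blockSignal e a I k = 0 ∧ v k = true).card := by
    rw [← Finset.card_sigma]
    refine Finset.card_le_card_of_injOn (fun p => e (p.1, p.2)) (fun p hp => ?_) ?_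
    · simp only [Finset.coe_sigma, Set.mem_sigma_iff, Finset.mem_coe, Finset.mem_erase, blockRej,
        Finset.mem_filter, Finset.mem_univ, true_and] at hp
      simpa using ⟨blockSignal_of_ne he a I hp.1, hp.2⟩
    · rintro ⟨j, i⟩ - ⟨j', i'⟩ - h
      have := he h
      simp only [Prod.mk.injEq] at this
      obtain ⟨rfl, rfl⟩ := this
      rfl
  have hfn : (Finset.univ.filter fun j => v (e (j, I j)) = false).card ≤
      (Finset.univ.filter fun k => blockSignal e a I k ≠ 0 ∧ v k = false).card := by
    refine Finset.card_le_card_of_injOn (fun j => e (j, I j)) (fun j hj => ?_)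
      (injective_block_position he I).injOn
    simp only [Finset.coe_filter, Finset.mem_univ, true_and, Set.mem_ofPred_eq] at hj ⊢
    exact ⟨by rw [blockSignal_apply he]; exact ha j, hj⟩
  have hblock : ρ * (Finset.univ.filter fun j => ¬ IsHit e ρ v j (I j)).card ≤
      ∑ j, ((blockRej e v j).erase (I j)).card +
        ρ * (Finset.univ.filter fun j => v (e (j, I j)) = false).card := by
    rw [Finset.card_filter, Finset.card_filter, Finset.mul_sum, Finset.mul_sum,
      ← Finset.sum_add_distrib]
    refine Finset.sum_le_sum fun j _ => ?_
    by_cases hv : v (e (j, I j)) = false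
    · simp only [hv, if_true]
      split_ifs <;> omega
    · have hmem : I j ∈ blockRej e v j := by simpa [blockRej] using hv
      have hcard := Finset.card_erase_of_mem hmem
      simp only [IsHit, hmem, true_and, hv]
      split_ifs <;> omega
  have h := hblock.trans (add_le_add hfp (Nat.mul_le_mul_left ρ hfn))
  unfold Lweight
  exact_mod_cast h

end Blocks

lemma prod_hit_weight {ι : Type*} [Fintype ι] (p : ι → Prop) {lam : ℝ} (hlam : 0 ≤ lam) :
    ∏ j, (ENNReal.ofReal (Real.exp (-lam)) + ENNReal.ofReal (1 - Real.exp (-lam)) *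
      if p j then 1 else 0) =
      ENNReal.ofReal (Real.exp (-lam * (Finset.univ.filter fun j => ¬ p j).card)) := by
  have hle : Real.exp (-lam) ≤ 1 := Real.exp_le_one_iff.mpr (by linarith)
  have hfac : ∀ j, ENNReal.ofReal (Real.exp (-lam)) + ENNReal.ofReal (1 - Real.exp (-lam)) *
      (if p j then 1 else 0) =
      if ¬ p j then ENNReal.ofReal (Real.exp (-lam)) else 1 := by
    intro j
    by_cases hp : p j
    · simp only [hp, if_true, mul_one, not_true, if_false]
      rw [← ENNReal.ofReal_add (Real.exp_pos _).le (by linarith)]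
      simp
    · simp [hp]
  simp_rw [hfac]
  rw [Finset.prod_ite, Finset.prod_const, Finset.prod_const_one, mul_one,
    ← ENNReal.ofReal_pow (Real.exp_pos _).le, ← Real.exp_nat_mul, mul_comm]

lemma exp_neg_le_quadratic {lam : ℝ} (hlam : 0 ≤ lam) :
    Real.exp (-lam) ≤ 1 - lam + lam ^ 2 / 2 := by
  have h := Real.quadratic_le_exp_of_nonneg hlam
  have hpos : 0 < 1 + lam + lam ^ 2 / 2 := by positivity
  rw [Real.exp_neg]
  refine (inv_anti₀ hpos h).trans ?_
  rw [inv_le_iff_one_le_mul₀ hpos]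
  nlinarith [sq_nonneg (lam ^ 2)]

lemma bernoulli_mgf_le {p lam : ℝ} (hp0 : 0 ≤ p) (hp1 : p ≤ 1) (hlam : 0 ≤ lam) :
    Real.exp (-lam) + (1 - Real.exp (-lam)) * (1 - p) ≤
      Real.exp (-lam * p + lam ^ 2 / 2) := by
  have h := exp_neg_le_quadratic hlam
  refine le_trans ?_ (Real.add_one_le_exp _)
  nlinarith [mul_le_mul_of_nonneg_left h hp0, mul_nonneg (sub_nonneg.mpr hp1) (sq_nonneg lam)]

lemma measurableSet_Lweight_lt {n : ℕ} {φ : (Fin n → ℝ) → Fin n → Bool} (hφ : Measurable φ)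
    (ρ u : ℝ) (θ : Fin n → ℝ) : MeasurableSet {x | Lweight ρ θ (φ x) < u} :=
  hφ (Set.toFinite {v | Lweight ρ θ v < u}).measurableSet

/-- Chernoff bound for the small loss probability, summed over all block signals. -/
lemma sum_obsLaw_Lweight_lt_le {ζ : ℝ} (hζ : 1 < ζ) {n s m : ℕ} {e : Fin s × Fin (m + 1) → Fin n}
    (he : Function.Injective e) {a : Fin s → ℝ} (ha : ∀ j, 0 < a j) {ρ : ℕ} (hρ : 1 ≤ ρ)
    {lam : ℝ} (hlam : 0 ≤ lam) (t : ℝ) {φ : (Fin n → ℝ) → Fin n → Bool} (hφ : Measurable φ) :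
    ∑ I, obsLaw ζ (blockSignal e a I) {x | Lweight ρ (blockSignal e a I) (φ x) < ρ * t} ≤
      ENNReal.ofReal (Real.exp (lam * t)) * ∏ j, ((m + 1 : ℕ) * (ENNReal.ofReal (Real.exp (-lam)) +
        ENNReal.ofReal (1 - Real.exp (-lam)) * topProb ζ m (a j) ρ)) := by
  have := isProbabilityMeasure_noiseMeasure hζ
  set P := Measure.pi fun _ : Fin n => noiseMeasure ζ
  set c := ENNReal.ofReal (Real.exp (-lam))
  set d := ENNReal.ofReal (1 - Real.exp (-lam))
  have hr : ∀ j, Measurable (shiftRatio ζ (a j)) := fun j => measurable_shiftRatio ζ (a j)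
  let W : Fin s → Fin (m + 1) → (Fin n → ℝ) → ℝ≥0∞ := fun j i x =>
    (c + d * if IsHit e ρ (φ x) j i then 1 else 0) * shiftRatio ζ (a j) (x (e (j, i)))
  have hW : ∀ j i, Measurable (W j i) := by
    intro j i
    have hit : Measurable fun x => if IsHit e ρ (φ x) j i then (1 : ℝ≥0∞) else 0 :=
      (measurable_of_finite fun v => if IsHit e ρ v j i then (1 : ℝ≥0∞) else 0).comp hφ
    have := hr j
    fun_prop
  have hbad : ∀ I, obsLaw ζ (blockSignal e a I)
      {x | Lweight ρ (blockSignal e a I) (φ x) < ρ * t} ≤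
      ∫⁻ x, ENNReal.ofReal (Real.exp (lam * t)) * ∏ j, W j (I j) x ∂P := by
    intro I
    have hB := measurableSet_Lweight_lt hφ ρ (ρ * t) (blockSignal e a I)
    rw [obsLaw_eq_withDensity hζ, withDensity_apply _ hB, ← lintegral_indicator hB]
    refine lintegral_mono fun x => ?_
    refine Set.indicator_apply_le' (fun hx => ?_) fun _ => zero_le
    have hcard : ((Finset.univ.filter fun j => ¬ IsHit e ρ (φ x) j (I j)).card : ℝ) ≤ t := by
      have h1 := card_miss_le_Lweight he (fun j => (ha j).ne') ρ I (φ x)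
      exact le_of_mul_le_mul_left (h1.trans (le_of_lt hx)) (by exact_mod_cast hρ)
    rw [prod_shiftRatio_blockSignal hζ he, Finset.prod_mul_distrib, prod_hit_weight _ hlam,
      ← mul_assoc, ← ENNReal.ofReal_mul (Real.exp_pos _).le, ← Real.exp_add]
    refine le_mul_of_one_le_left' ?_
    rw [ENNReal.one_le_ofReal, Real.one_le_exp_iff]
    nlinarith
  calc ∑ I, obsLaw ζ (blockSignal e a I) {x | Lweight ρ (blockSignal e a I) (φ x) < ρ * t}
      ≤ ∑ I : Fin s → Fin (m + 1),
          ∫⁻ x, ENNReal.ofReal (Real.exp (lam * t)) * ∏ j, W j (I j) x ∂P :=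
        Finset.sum_le_sum fun I _ => hbad I
    _ = ∫⁻ x, ENNReal.ofReal (Real.exp (lam * t)) * ∏ j, ∑ i, W j i x ∂P := by
        rw [← lintegral_finsetSum _ fun I _ => by fun_prop]
        refine lintegral_congr fun x => ?_
        rw [← Finset.mul_sum, Finset.prod_univ_sum, Fintype.piFinset_univ]
    _ ≤ ∫⁻ x, ENNReal.ofReal (Real.exp (lam * t)) *
          ∏ j, blockWeight ζ (a j) ρ c d (fun i => x (e (j, i))) ∂P := by
        refine lintegral_mono fun x => mul_le_mul_right (Finset.prod_le_prod' fun j _ => ?_) _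
        refine le_of_eq_of_le (Finset.sum_congr rfl fun i _ => ?_) (sum_weight_le_blockWeight hζ (ha j).le ρ c d (fun i => x (e (j, i)))
          (blockRej e (φ x) j))
        simp only [W, IsHit]
        congr
    _ = _ := by
        have hG : ∀ j, Measurable (blockWeight ζ (a j) ρ c d (q := m + 1)) :=
          fun j => measurable_blockWeight ζ (a j) ρ c d
        rw [lintegral_const_mul _ (by fun_prop), lintegral_prod_blocks _ he hG]
        simp_rw [lintegral_blockWeight hζ]

/-- Some block signal makes a small loss exponentially unlikely. -/
lemma exists_blockSignal_obsLaw_le {ζ : ℝ} (hζ : 1 < ζ) {n s m : ℕ} (hm : n / s = m + 1)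
    {e : Fin s × Fin (m + 1) → Fin n} (he : Function.Injective e) {b : Fin s → ℝ}
    (hb : ∀ j, 0 < astar ζ n s + b j) {ρ : ℕ} (hρ : 1 ≤ ρ) {ε : ℝ} (hε : 0 ≤ ε)
    {φ : (Fin n → ℝ) → Fin n → Bool} (hφ : Measurable φ) :
    ∃ I, (obsLaw ζ (blockSignal e (fun j => astar ζ n s + b j) I)).real
        {x | Lweight ρ (blockSignal e (fun j => astar ζ n s + b j) I) (φ x) <
          ρ * (∑ j, pn ζ n s (b j) ρ - s * ε)} ≤ Real.exp (-(s * ε ^ 2 / 2)) := by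
  have hprob := fun θ : Fin n → ℝ => isProbabilityMeasure_obsLaw hζ θ
  set t := ∑ j, pn ζ n s (b j) ρ - s * ε
  have hsum := sum_obsLaw_Lweight_lt_le hζ he hb hρ hε t hφ
  have hle : Real.exp (-ε) ≤ 1 := Real.exp_le_one_iff.mpr (by linarith)
  have hfac : ∀ j, (m + 1 : ℕ) * (ENNReal.ofReal (Real.exp (-ε)) +
      ENNReal.ofReal (1 - Real.exp (-ε)) * topProb ζ m (astar ζ n s + b j) ρ) ≤
      ENNReal.ofReal ((m + 1 : ℕ) * Real.exp (-ε * pn ζ n s (b j) ρ + ε ^ 2 / 2)) := by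
    intro j
    have hp := pn_le_one hζ n s (b j) ρ
    rw [topProb_eq hζ hm, ← ENNReal.ofReal_mul (by linarith),
      ← ENNReal.ofReal_add (Real.exp_pos _).le (mul_nonneg (by linarith) (by linarith)),
      ENNReal.ofReal_mul (by positivity), ENNReal.ofReal_natCast]
    gcongr
    exact bernoulli_mgf_le (pn_nonneg _ _ _ _ _) hp hε
  have hbound : ∑ I, obsLaw ζ (blockSignal e (fun j => astar ζ n s + b j) I)
      {x | Lweight ρ (blockSignal e (fun j => astar ζ n s + b j) I) (φ x) < ρ * t} ≤
      ENNReal.ofReal (((m + 1 : ℕ) : ℝ) ^ s * Real.exp (-(s * ε ^ 2 / 2))) := by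
    refine hsum.trans ((mul_le_mul_right (Finset.prod_le_prod' fun j _ => hfac j) _).trans_eq ?_)
    rw [← ENNReal.ofReal_prod_of_nonneg fun j _ => by positivity,
      ← ENNReal.ofReal_mul (Real.exp_pos _).le, Finset.prod_mul_distrib, ← Real.exp_sum,
      Finset.prod_const, Finset.sum_add_distrib, ← Finset.mul_sum, mul_left_comm, ← Real.exp_add]
    congr 3
    · simp
    · simp [t]
      ring
  have hreal : ∑ I, (obsLaw ζ (blockSignal e (fun j => astar ζ n s + b j) I)).real
      {x | Lweight ρ (blockSignal e (fun j => astar ζ n s + b j) I) (φ x) < ρ * t} ≤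
      ∑ _I : Fin s → Fin (m + 1), Real.exp (-(s * ε ^ 2 / 2)) := by
    have h := ENNReal.toReal_mono ENNReal.ofReal_ne_top hbound
    rw [ENNReal.toReal_sum fun I _ => measure_ne_top _ _,
      ENNReal.toReal_ofReal (by positivity)] at h
    simpa [Measure.real] using h
  obtain ⟨I, -, hI⟩ := Finset.exists_le_of_sum_le Finset.univ_nonempty hreal
  exact ⟨I, hI⟩

theorem statement_12 (ζ : ℝ) (hζ : 1 < ζ) (n s : ℕ)
    (hs : 4 < s) (hsn : s ≤ n)
    (ρ : ℕ) (hρ : 1 ≤ ρ) (ε : ℝ) (hε : ε ∈ Set.Icc (0 : ℝ) 1)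
    (b : Fin s → ℝ) (hb : ∀ j, -(astar ζ n s) < b j)
    (φ : (Fin n → ℝ) → (Fin n → Bool)) (hφ : Measurable φ) :
    1 - Real.exp (-Real.sqrt (s : ℝ) * ε ^ 2 / 3) ≤
      ⨆ θ ∈ ThetaMult ζ n s b,
        (obsLaw ζ θ {x |
            min (1 - (1 + ε) / Real.sqrt (s : ℝ)) (Fcal ζ n s b ρ - ε) * ((ρ : ℝ) * (s : ℝ))
              ≤ Lweight (ρ : ℝ) θ (φ x)}).toReal := by
  have hs0 : 0 < s := by omega
  have hsR : (1 : ℝ) ≤ s := by exact_mod_cast hs0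
  obtain ⟨m, hm⟩ : ∃ m, n / s = m + 1 := ⟨n / s - 1, by have := Nat.div_pos hsn hs0; omega⟩
  have hle : s * (m + 1) ≤ n := hm ▸ Nat.mul_div_le n s
  have he : Function.Injective fun p : Fin s × Fin (m + 1) => Fin.castLE hle (finProdFinEquiv p) :=
    (Fin.castLE_injective hle).comp finProdFinEquiv.injective
  obtain ⟨I, hI⟩ := exists_blockSignal_obsLaw_le hζ hm he
    (fun j => by linarith [hb j] : ∀ j, 0 < astar ζ n s + b j) hρ hε.1 hφ
  set θ := blockSignal (fun p => Fin.castLE hle (finProdFinEquiv p))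
    (fun j => astar ζ n s + b j) I
  have hθ : θ ∈ ThetaMult ζ n s b := blockSignal_mem_ThetaMult he b I
  have hprob := fun θ : Fin n → ℝ => isProbabilityMeasure_obsLaw hζ θ
  have hexp : Real.exp (-(s * ε ^ 2 / 2)) ≤ Real.exp (-Real.sqrt (s : ℝ) * ε ^ 2 / 3) := by
    have hsqrt : Real.sqrt s ≤ s := Real.sqrt_le_iff.mpr ⟨by linarith, by nlinarith⟩
    rw [Real.exp_le_exp]
    nlinarith [mul_le_mul_of_nonneg_right hsqrt (sq_nonneg ε),
      mul_nonneg (by linarith : (0 : ℝ) ≤ s) (sq_nonneg ε)]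
  have hthr : min (1 - (1 + ε) / Real.sqrt (s : ℝ)) (Fcal ζ n s b ρ - ε) * ((ρ : ℝ) * (s : ℝ)) ≤
      ρ * (∑ j, pn ζ n s (b j) ρ - s * ε) := by
    have hF : Fcal ζ n s b ρ * s = ∑ j, pn ζ n s (b j) ρ := by
      rw [Fcal, div_mul_cancel₀ _ (by positivity)]
    calc _ ≤ (Fcal ζ n s b ρ - ε) * ((ρ : ℝ) * (s : ℝ)) :=
          mul_le_mul_of_nonneg_right (min_le_right _ _) (by positivity)
      _ = _ := by
          rw [← hF]
          ring
  set u := min (1 - (1 + ε) / Real.sqrt (s : ℝ)) (Fcal ζ n s b ρ - ε) * ((ρ : ℝ) * (s : ℝ))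
  have hgood : 1 - Real.exp (-Real.sqrt (s : ℝ) * ε ^ 2 / 3) ≤
      (obsLaw ζ θ).real {x | u ≤ Lweight (ρ : ℝ) θ (φ x)} := by
    have hcompl : {x | u ≤ Lweight (ρ : ℝ) θ (φ x)} = {x | Lweight (ρ : ℝ) θ (φ x) < u}ᶜ := by
      ext x
      simp
    rw [hcompl, probReal_compl_eq_one_sub (measurableSet_Lweight_lt hφ ρ u θ)]
    have hmono : (obsLaw ζ θ).real {x | Lweight (ρ : ℝ) θ (φ x) < u} ≤
        Real.exp (-(s * ε ^ 2 / 2)) :=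
      (measureReal_mono fun x hx => lt_of_lt_of_le hx hthr).trans hI
    linarith
  refine hgood.trans (le_trans ?_ (le_ciSup (f := fun θ => ⨆ _ : θ ∈ ThetaMult ζ n s b,
    (obsLaw ζ θ {x | u ≤ Lweight (ρ : ℝ) θ (φ x)}).toReal) ⟨1, ?_⟩ θ))
  · simp only [hθ, ciSup_unique]
    rfl
  · rintro _ ⟨θ', rfl⟩
    exact Real.iSup_le (fun _ => measureReal_le_one) zero_le_one
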